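/- For each 0 ≤ i ≤ p−1 one has E[Z̃_{i+1}²] = (n²β₄ − 1)(E[tr(Q_i²)] − 1/(n−1)) + E[tr(Q_i²)](n²β₄ − 1)/(n−1) + n²β_{2,2} Var(tr(Q_i)), where β₄ = E[U₁₁⁴] = 3/(n(n+2)) and β_{2,2} = E[U₁₁² U₁₂²] = 1/(n(n+2)) are the fourth-order moments of the components of a uniform random point (U₁₁,…,U₁ₙ) on S^{n−1}. -/

import Mathlib

open MeasureTheory ProbabilityTheory Matrix Filter Topology

noncomputable section

/-- The standard Gaussian measure on `ℝ^d` (modeled on `Fin d → ℝ`). -/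
def gaussianPi (d : ℕ) : Measure (Fin d → ℝ) :=
  Measure.pi fun _ => gaussianReal 0 1

/-- The Euclidean norm on `Fin n → ℝ`. -/
def euclidNorm {n : ℕ} (x : Fin n → ℝ) : ℝ :=
  Real.sqrt (∑ j, x j ^ 2)

/-- The uniform distribution on the unit sphere `S^{n-1} ⊆ ℝ^n`, realized as the law of a
normalized standard Gaussian vector. -/
def uniformSphere (n : ℕ) : Measure (Fin n → ℝ) :=
  (gaussianPi n).map fun x => (euclidNorm x)⁻¹ • x

/-- The joint law of `p` independent uniform random directions `u_1, …, u_p` on `S^{n-1}`. -/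
def sphereLaw (n p : ℕ) : Measure (Fin p → Fin n → ℝ) :=
  Measure.pi fun _ => uniformSphere n

/-- The `(i+1)`-st sample vector `u_{i+1}` (junk value `0` if `i ≥ p`). -/
def uVec {n p : ℕ} (ω : Fin p → Fin n → ℝ) (i : ℕ) : Fin n → ℝ :=
  if h : i < p then ω ⟨i, h⟩ else 0

/-- The matrix `B_{(i)} = (b_1, …, b_i)ᵀ` with rows `b_j = A u_j`. -/
def rowMat {n p : ℕ} (A : Matrix (Fin n) (Fin n) ℝ) (ω : Fin p → Fin n → ℝ) (i : ℕ) :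
    Matrix (Fin i) (Fin n) ℝ :=
  Matrix.of fun k j => A.mulVec (uVec ω (k : ℕ)) j

/-- The projection matrix `P_i = I_n − B_{(i)}ᵀ (B_{(i)} B_{(i)}ᵀ)⁻¹ B_{(i)}` (with `P_0 = I_n`). -/
def projMat {n p : ℕ} (A : Matrix (Fin n) (Fin n) ℝ) (ω : Fin p → Fin n → ℝ) (i : ℕ) :
    Matrix (Fin n) (Fin n) ℝ :=
  1 - (rowMat A ω i)ᵀ * (rowMat A ω i * (rowMat A ω i)ᵀ)⁻¹ * rowMat A ω i

/-- The entrywise expectation `E[P_i]` of the projection matrix `P_i`. -/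
def meanProj (n p : ℕ) (A : Matrix (Fin n) (Fin n) ℝ) (i : ℕ) :
    Matrix (Fin n) (Fin n) ℝ :=
  Matrix.of fun k l => ∫ ω, projMat A ω i k l ∂(sphereLaw n p)

/-- `T_i = tr(A² E[P_i])`. -/
def Tstat (n p : ℕ) (A : Matrix (Fin n) (Fin n) ℝ) (i : ℕ) : ℝ :=
  Matrix.trace (A * A * meanProj n p A i)

/-- `Q_i = A P_i A / T_i`. -/
def Qmat {n p : ℕ} (A : Matrix (Fin n) (Fin n) ℝ) (ω : Fin p → Fin n → ℝ) (i : ℕ) :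
    Matrix (Fin n) (Fin n) ℝ :=
  (Tstat n p A i)⁻¹ • (A * projMat A ω i * A)

/-- `Z̃_{i+1} = n u_{i+1}ᵀ Q_i u_{i+1} − 1`. -/
def Ztil {n p : ℕ} (A : Matrix (Fin n) (Fin n) ℝ) (ω : Fin p → Fin n → ℝ) (i : ℕ) : ℝ :=
  (n : ℝ) * (uVec ω i ⬝ᵥ (Qmat A ω i).mulVec (uVec ω i)) - 1

/-- The variance `Var(f) = E[(f − E f)²]` of a real random variable `f` under `μ`. -/
def varInt {α : Type*} [MeasurableSpace α] (μ : Measure α) (f : α → ℝ) : ℝ :=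
  ∫ ω, (f ω - ∫ ω', f ω' ∂μ) ^ 2 ∂μ

end

lemma euclidNorm_smul' {n : ℕ} (c : ℝ) (hc : 0 ≤ c) (x : Fin n → ℝ) :
    euclidNorm (c • x) = c * euclidNorm x := by
  unfold euclidNorm
  simp only [Pi.smul_apply, smul_eq_mul, mul_pow, ← Finset.mul_sum]
  rw [Real.sqrt_mul (by positivity), Real.sqrt_sq hc]

lemma measurable_euclidNorm {n : ℕ} : Measurable (euclidNorm (n := n)) := by
  unfold euclidNorm
  fun_prop

lemma measurable_normalize {n : ℕ} :
    Measurable (fun x : Fin n → ℝ => (euclidNorm x)⁻¹ • x) :=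
  (measurable_euclidNorm.inv).smul measurable_id

instance (n : ℕ) : IsProbabilityMeasure (gaussianPi n) := by
  unfold gaussianPi; infer_instance

instance (n : ℕ) : IsProbabilityMeasure (uniformSphere n) :=
  Measure.isProbabilityMeasure_map measurable_normalize.aemeasurable

instance (n p : ℕ) : IsProbabilityMeasure (sphereLaw n p) := by
  unfold sphereLaw; infer_instance

lemma gaussianPi_map {n : ℕ} (f : (Fin n → ℝ) →ₗ[ℝ] (Fin n → ℝ))
    (hf : ∀ x, ∑ j, f x j ^ 2 = ∑ j, x j ^ 2) :
    (gaussianPi n).map f = gaussianPi n := by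
  classical
  let e : EuclideanSpace ℝ (Fin n) ≃ₗ[ℝ] (Fin n → ℝ) := WithLp.linearEquiv 2 ℝ (Fin n → ℝ)
  let g : EuclideanSpace ℝ (Fin n) →ₗᵢ[ℝ] EuclideanSpace ℝ (Fin n) :=
    { toLinearMap := e.symm.toLinearMap ∘ₗ f ∘ₗ e.toLinearMap
      norm_map' := by
        intro x
        rw [EuclideanSpace.norm_eq, EuclideanSpace.norm_eq]
        congr 1
        simpa using! hf (e x) }
  let g' := g.toLinearIsometryEquiv rfl
  have h1 := stdGaussian_map g'
  have hfm : Measurable f := f.continuous_of_finiteDimensional.measurable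
  rw [← map_pi_eq_stdGaussian, Measure.map_map (by fun_prop) (by fun_prop)] at h1
  have h2 : (g' ∘ WithLp.toLp 2) = (WithLp.toLp 2) ∘ f := by
    funext x; rfl
  rw [h2, ← Measure.map_map (by fun_prop) hfm] at h1
  have h3 := congrArg (Measure.map (WithLp.ofLp (p := 2))) h1
  rw [Measure.map_map (by fun_prop) (by fun_prop), Measure.map_map (by fun_prop) (by fun_prop)] at h3
  have h4 : (WithLp.ofLp (p := 2)) ∘ (WithLp.toLp 2 : (Fin n → ℝ) → _) = id := rfl
  rw [Measure.map_map (by fun_prop) (by fun_prop), h4, Function.id_comp, Measure.map_id] at h3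
  exact h3

lemma uniformSphere_map {n : ℕ} (f : (Fin n → ℝ) →ₗ[ℝ] (Fin n → ℝ))
    (hf : ∀ x, ∑ j, f x j ^ 2 = ∑ j, x j ^ 2) :
    (uniformSphere n).map f = uniformSphere n := by
  have hfm : Measurable f := f.continuous_of_finiteDimensional.measurable
  unfold uniformSphere
  rw [Measure.map_map hfm measurable_normalize]
  conv_rhs => rw [← gaussianPi_map f hf, Measure.map_map measurable_normalize hfm]
  congr 1
  funext x
  simp only [Function.comp, map_smul]
  congr 2
  unfold euclidNorm
  rw [hf]

/-- Householder reflection. -/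
noncomputable def house {n : ℕ} (v : Fin n → ℝ) : (Fin n → ℝ) →ₗ[ℝ] (Fin n → ℝ) where
  toFun x := x - (2 / (v ⬝ᵥ v) * (v ⬝ᵥ x)) • v
  map_add' x y := by
    ext j; simp [dotProduct_add]; ring
  map_smul' c x := by
    ext j; simp [dotProduct_smul]; ring

lemma house_apply {n : ℕ} (v x : Fin n → ℝ) (j : Fin n) :
    house v x j = x j - (2 / (v ⬝ᵥ v) * (v ⬝ᵥ x)) * v j := rfl

lemma house_norm {n : ℕ} (v x : Fin n → ℝ) : ∑ j, house v x j ^ 2 = ∑ j, x j ^ 2 := by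
  have : ∀ t : ℝ, ∑ j, (x j - t * v j) ^ 2 = ∑ j, x j ^ 2 - 2 * t * (v ⬝ᵥ x) + t ^ 2 * (v ⬝ᵥ v) := by
    intro t
    simp only [dotProduct, Finset.mul_sum, ← Finset.sum_sub_distrib, ← Finset.sum_add_distrib]
    exact Finset.sum_congr rfl fun j _ => by ring
  simp only [house_apply]
  rw [this]
  by_cases h : v ⬝ᵥ v = 0
  · simp [h]
  · field_simp; ring

lemma integral_house {n : ℕ} (v : Fin n → ℝ) (g : (Fin n → ℝ) → ℝ) (hg : Measurable g) :
    ∫ x, g (house v x) ∂(uniformSphere n) = ∫ x, g x ∂(uniformSphere n) := by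
  have hfm : Measurable (house v) := (house v).continuous_of_finiteDimensional.measurable
  conv_rhs => rw [← uniformSphere_map (house v) (house_norm v)]
  rw [integral_map hfm.aemeasurable hg.aestronglyMeasurable]

lemma sphere_norm {n : ℕ} (hn : 0 < n) : ∀ᵐ x ∂(uniformSphere n), ∑ j, x j ^ 2 = 1 := by
  unfold uniformSphere
  rw [ae_map_iff measurable_normalize.aemeasurable
    (measurableSet_eq_fun (by fun_prop) (by fun_prop))]
  have : ∀ᵐ x ∂(gaussianPi n), x ≠ 0 := by
    have h0 : ∀ᵐ t ∂(gaussianReal 0 1), t ≠ 0 := by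
      have : NullSingletonClass (gaussianReal 0 1) := nullSingletonClass_gaussianReal one_ne_zero
      simp [ae_iff]
    have := (Measure.quasiMeasurePreserving_eval (μ := fun _ : Fin n => gaussianReal 0 1) ⟨0, hn⟩).ae h0
    unfold gaussianPi
    filter_upwards [this] with x hx h
    exact hx (by rw [h]; rfl)
  filter_upwards [this] with x hx
  have h0 : 0 < ∑ j, x j ^ 2 := by
    obtain ⟨k, hk⟩ := Function.ne_iff.mp hx
    have hk' : x k ≠ 0 := hk
    exact Finset.sum_pos' (fun j _ => sq_nonneg _) ⟨k, Finset.mem_univ _, by positivity⟩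
  simp only [Pi.smul_apply, smul_eq_mul, mul_pow, ← Finset.mul_sum]
  unfold euclidNorm
  rw [inv_pow, Real.sq_sqrt h0.le]
  field_simp

lemma sphere_le {n : ℕ} (hn : 0 < n) : ∀ᵐ x ∂(uniformSphere n), ∀ j, |x j| ≤ 1 := by
  filter_upwards [sphere_norm hn] with x hx j
  rw [← sq_le_one_iff_abs_le_one, ← hx]
  exact Finset.single_le_sum (f := fun j => x j ^ 2) (fun j _ => sq_nonneg _) (Finset.mem_univ j)

lemma int4 {n : ℕ} (hn : 0 < n) (a b c d : Fin n) :
    Integrable (fun x : Fin n → ℝ => x a * x b * x c * x d) (uniformSphere n) := by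
  refine Integrable.of_bound (C := 1) (by fun_prop) ?_
  filter_upwards [sphere_le hn] with x hx
  simp only [norm_mul, Real.norm_eq_abs]
  have := hx a; have := hx b; have := hx c; have := hx d
  calc |x a| * |x b| * |x c| * |x d| ≤ 1 * 1 * 1 * 1 := by gcongr
    _ = 1 := by norm_num

/-- Fourth moments. -/
noncomputable def M4 {n : ℕ} (a b c d : Fin n) : ℝ := ∫ x, x a * x b * x c * x d ∂(uniformSphere n)

lemma M4_odd {n : ℕ} (a b c d : Fin n) (hb : b ≠ a) (hc : c ≠ a) (hd : d ≠ a) :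
    M4 a b c d = 0 := by
  have h := integral_house (Pi.single a 1) (fun x => x a * x b * x c * x d) (by fun_prop)
  simp only [house_apply, single_dotProduct, Pi.single_eq_same, Pi.single_eq_of_ne hb,
    Pi.single_eq_of_ne hc, Pi.single_eq_of_ne hd] at h
  have h2 : ∀ x : Fin n → ℝ, (x a - 2 / (1 * 1) * (1 * x a) * 1) * (x b - 2 / (1 * 1) * (1 * x a) * 0)
      * (x c - 2 / (1 * 1) * (1 * x a) * 0) * (x d - 2 / (1 * 1) * (1 * x a) * 0)
      = - (x a * x b * x c * x d) := fun x => by ring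
  simp only [h2, integral_neg] at h
  unfold M4
  linarith

lemma M4_swap {n : ℕ} (a b : Fin n) (hab : a ≠ b) : M4 a a a a = M4 b b b b := by
  have h := integral_house (Pi.single a 1 - Pi.single b 1) (fun x => x a * x a * x a * x a)
    (by fun_prop)
  simp only [house_apply, sub_dotProduct, single_dotProduct, Pi.sub_apply, Pi.single_eq_same,
    Pi.single_eq_of_ne hab, Pi.single_eq_of_ne hab.symm] at h
  unfold M4
  rw [← h]
  congr 1; funext x; ring

lemma M4_perm1 {n : ℕ} (a b c d : Fin n) : M4 a b c d = M4 b a c d := by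
  unfold M4; congr 1; funext x; ring
lemma M4_perm2 {n : ℕ} (a b c d : Fin n) : M4 a b c d = M4 c a b d := by
  unfold M4; congr 1; funext x; ring
lemma M4_perm3 {n : ℕ} (a b c d : Fin n) : M4 a b c d = M4 d a b c := by
  unfold M4; congr 1; funext x; ring

lemma M4_rot {n : ℕ} (hn : 0 < n) (a b : Fin n) (hab : a ≠ b) :
    M4 a a a a = 3 * M4 a a b b := by
  have h := integral_house (Pi.single a 1 + Pi.single b 2) (fun x => x a * x a * x a * x a)
    (by fun_prop)
  simp only [house_apply, add_dotProduct, single_dotProduct, Pi.add_apply, Pi.single_eq_same,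
    Pi.single_eq_of_ne hab, Pi.single_eq_of_ne hab.symm] at h
  have h2 : ∀ x : Fin n → ℝ, (x a - 2 / (1 * (1 + 0) + 2 * (0 + 2)) * (1 * x a + 2 * x b) * (1 + 0)) *
      (x a - 2 / (1 * (1 + 0) + 2 * (0 + 2)) * (1 * x a + 2 * x b) * (1 + 0)) *
      (x a - 2 / (1 * (1 + 0) + 2 * (0 + 2)) * (1 * x a + 2 * x b) * (1 + 0)) *
      (x a - 2 / (1 * (1 + 0) + 2 * (0 + 2)) * (1 * x a + 2 * x b) * (1 + 0))
      = (81/625) * (x a * x a * x a * x a) + (256/625) * (x b * x b * x b * x b)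
        + (864/625) * (x a * x a * x b * x b) + (-432/625) * (x b * x a * x a * x a)
        + (-768/625) * (x a * x b * x b * x b) := fun x => by ring
  simp only [h2] at h
  have i1 := (int4 hn a a a a).const_mul (81/625)
  have i2 := (int4 hn b b b b).const_mul (256/625)
  have i3 := (int4 hn a a b b).const_mul (864/625)
  have i4 := (int4 hn b a a a).const_mul (-432/625)
  have i5 := (int4 hn a b b b).const_mul (-768/625)
  have j2 := i1.add i2
  have j3 := j2.add i3
  have j4 := j3.add i4
  rw [integral_add, integral_add, integral_add, integral_add] at h
  rotate_left
  all_goals first | exact i1 | exact i2 | exact i3 | exact i4 | exact i5 | exact j2 | exact j3 | exact j4 | skip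
  simp only [integral_const_mul] at h
  have o1 := M4_odd b a a a hab hab hab
  have o2 := M4_odd a b b b hab.symm hab.symm hab.symm
  have s := M4_swap a b hab
  unfold M4 at *
  linarith

lemma M4_aabb {n : ℕ} (hn : 0 < n) (a b : Fin n) :
    M4 a a b b = 1 / ((n : ℝ) * (n + 2)) * (1 + if a = b then 2 else 0) := by
  have key : ∀ c d : Fin n, M4 c c d d = M4 a a a a / 3 * (1 + if c = d then 2 else 0) := by
    intro c d
    have hc : M4 c c c c = M4 a a a a := by
      by_cases h : c = a
      · rw [h]
      · exact M4_swap c a h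
    by_cases h : c = d
    · subst h; rw [hc]; simp; ring
    · have := M4_rot hn c d h
      simp [h]; linarith
  have hsum : ∑ c : Fin n, ∑ d : Fin n, M4 c c d d = 1 := by
    unfold M4
    simp_rw [← integral_finsetSum Finset.univ (fun d _ => int4 hn _ _ d d)]
    rw [← integral_finsetSum]
    · have : (fun x : Fin n → ℝ => ∑ c, ∑ d, x c * x c * x d * x d) =ᵐ[uniformSphere n] fun _ => 1 := by
        filter_upwards [sphere_norm hn] with x hx
        calc ∑ c, ∑ d, x c * x c * x d * x d = (∑ c, x c ^ 2) * (∑ d, x d ^ 2) := by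
              rw [Finset.sum_mul_sum]
              exact Finset.sum_congr rfl fun c _ => Finset.sum_congr rfl fun d _ => by ring
          _ = 1 := by rw [hx]; norm_num
      rw [integral_congr_ae this]; simp
    · intro c _
      exact integrable_finsetSum _ fun d _ => int4 hn c c d d
  obtain ⟨D, hD⟩ : ∃ D, D = M4 a a a a / 3 := ⟨_, rfl⟩
  rw [← hD] at key
  simp_rw [key, ← Finset.mul_sum, Finset.sum_add_distrib] at hsum
  simp at hsum
  have hn' : (0:ℝ) < n := by exact_mod_cast hn
  rw [key a b]
  congr 1
  field_simp
  linarith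

lemma M4_eq {n : ℕ} (hn : 0 < n) (a b c d : Fin n) :
    M4 a b c d = 1 / ((n : ℝ) * (n + 2)) * ((if a = b then (if c = d then 1 else 0) else 0)
      + (if a = c then (if b = d then 1 else 0) else 0)
      + (if a = d then (if b = c then 1 else 0) else 0)) := by
  by_cases hab : a = b
  · subst hab
    by_cases hcd : c = d
    · subst hcd
      rw [M4_aabb hn]
      by_cases hac : a = c
      · simp [hac]; norm_num
      · simp [hac]
    · have : M4 a a c d = 0 := by
        by_cases hac : a = c
        · subst hac
          rw [M4_perm3]; exact M4_odd _ _ _ _ hcd hcd hcd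
        · rw [M4_perm2]; exact M4_odd _ _ _ _ hac hac (Ne.symm hcd)
      rw [this]
      by_cases hac : a = c
      · subst hac; simp [hcd]
      · simp [hac, hcd]
  · by_cases hac : a = c
    · subst hac
      by_cases hbd : b = d
      · subst hbd
        have : M4 a b a b = M4 a a b b := by unfold M4; congr 1; funext x; ring
        rw [this, M4_aabb hn]; simp [hab]
      · have : M4 a b a d = 0 := by
          rw [M4_perm1]; exact M4_odd _ _ _ _ hab hab (Ne.symm hbd)
        rw [this]; simp [hab, hbd, Ne.symm hab]
    · by_cases had : a = d
      · subst had
        by_cases hbc : b = c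
        · subst hbc
          have : M4 a b b a = M4 a a b b := by unfold M4; congr 1; funext x; ring
          rw [this, M4_aabb hn]; simp [hab]
        · have : M4 a b c a = 0 := by
            rw [M4_perm1]; exact M4_odd _ _ _ _ hab (Ne.symm hbc) hab
          rw [this]; simp [hab, hac, hbc]
      · rw [M4_odd _ _ _ _ (Ne.symm hab) (Ne.symm hac) (Ne.symm had)]
        simp [hab, hac, had]

lemma M2_eq {n : ℕ} (hn : 0 < n) (a b : Fin n) :
    ∫ x, x a * x b ∂(uniformSphere n) = 1 / (n : ℝ) * (if a = b then 1 else 0) := by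
  have h : ∫ x, x a * x b ∂(uniformSphere n) = ∑ c, M4 a b c c := by
    unfold M4
    rw [← integral_finsetSum Finset.univ (fun c _ => int4 hn a b c c)]
    refine integral_congr_ae ?_
    filter_upwards [sphere_norm hn] with x hx
    calc x a * x b = x a * x b * ∑ c, x c ^ 2 := by rw [hx, mul_one]
      _ = _ := by rw [Finset.mul_sum]; exact Finset.sum_congr rfl fun c _ => by ring
  rw [h]
  simp_rw [M4_eq hn, ← Finset.mul_sum, Finset.sum_add_distrib]
  have hn' : (0:ℝ) < n := by exact_mod_cast hn
  by_cases hab : a = b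
  · subst hab
    simp
    field_simp
    ring
  · simp [hab, Ne.symm hab]

lemma integral_factor {n p : ℕ} (k : Fin p) (F : (Fin p → Fin n → ℝ) → ℝ) (g : (Fin n → ℝ) → ℝ)
    (hF : ∀ ω ω', (∀ j, j ≠ k → ω j = ω' j) → F ω = F ω') :
    ∫ ω, F ω * g (ω k) ∂(sphereLaw n p)
      = (∫ ω, F ω ∂(sphereLaw n p)) * ∫ x, g x ∂(uniformSphere n) := by
  obtain _ | q := p
  · exact k.elim0
  have hmp := (measurePreserving_piFinSuccAbove (fun _ : Fin (q + 1) => uniformSphere n) k).symm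
  let e := (MeasurableEquiv.piFinSuccAbove (fun _ : Fin (q + 1) => Fin n → ℝ) k).symm
  have e1 : ∀ z, e z k = z.1 := by
    intro z
    change Fin.insertNth (α := fun _ => Fin n → ℝ) k z.1 z.2 k = z.1
    simp
  have e2 : ∀ z, F (e z) = F (e (0, z.2)) := by
    intro z
    apply hF
    intro j hj
    obtain ⟨l, rfl⟩ := Fin.exists_succAbove_eq hj
    change Fin.insertNth (α := fun _ => Fin n → ℝ) k z.1 z.2 (k.succAbove l)
      = Fin.insertNth (α := fun _ => Fin n → ℝ) k 0 z.2 (k.succAbove l)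
    simp
  have h1 : ∀ G : (Fin (q + 1) → Fin n → ℝ) → ℝ, ∫ ω, G ω ∂(sphereLaw n (q + 1))
      = ∫ z, G (e z) ∂((uniformSphere n).prod (Measure.pi fun _ : Fin q => uniformSphere n)) :=
    fun G => (hmp.integral_comp' G).symm
  rw [h1, h1]
  simp_rw [e1]
  have h2 := integral_prod_mul (μ := uniformSphere n)
    (ν := Measure.pi fun _ : Fin q => uniformSphere n) g (fun y => F (e (0, y)))
  have h3 := integral_prod_mul (μ := uniformSphere n)
    (ν := Measure.pi fun _ : Fin q => uniformSphere n) (fun _ => (1 : ℝ)) (fun y => F (e (0, y)))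
  simp only [one_mul, integral_const, probReal_univ, smul_eq_mul] at h3
  calc _ = ∫ z, g z.1 * F (e (0, z.2)) ∂((uniformSphere n).prod
          (Measure.pi fun _ : Fin q => uniformSphere n)) := by
        congr 1; funext z; rw [e2 z, mul_comm]
    _ = _ := by
        rw [h2, mul_comm, ← h3]
        congr 2; funext z; rw [e2 z]

lemma law_le {n p : ℕ} (hn : 0 < n) (k : Fin p) :
    ∀ᵐ ω ∂(sphereLaw n p), ∀ j, |ω k j| ≤ 1 :=
  (Measure.quasiMeasurePreserving_eval (μ := fun _ : Fin p => uniformSphere n) k).ae (sphere_le hn)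

section proj
variable {n p : ℕ} (A : Matrix (Fin n) (Fin n) ℝ) (ω : Fin p → Fin n → ℝ) (i : ℕ)

lemma proj_symm : (projMat A ω i)ᵀ = projMat A ω i := by
  unfold projMat
  simp [Matrix.transpose_mul, Matrix.transpose_nonsing_inv, Matrix.mul_assoc]

lemma proj_idem : projMat A ω i * projMat A ω i = projMat A ω i := by
  unfold projMat
  set B := rowMat A ω i
  have h : Bᵀ * (B * Bᵀ)⁻¹ * B * (Bᵀ * (B * Bᵀ)⁻¹ * B) = Bᵀ * (B * Bᵀ)⁻¹ * B := by
    by_cases hd : IsUnit (B * Bᵀ).det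
    · calc _ = Bᵀ * ((B * Bᵀ)⁻¹ * (B * Bᵀ)) * (B * Bᵀ)⁻¹ * B := by
            simp only [Matrix.mul_assoc]
        _ = _ := by rw [Matrix.nonsing_inv_mul _ hd, Matrix.mul_one]
    · rw [Matrix.nonsing_inv_apply_not_isUnit _ hd]; simp
  rw [Matrix.sub_mul, Matrix.mul_sub, Matrix.mul_sub, h]
  simp

lemma proj_trace : (n : ℝ) - i ≤ (projMat A ω i).trace := by
  unfold projMat
  set B := rowMat A ω i
  rw [Matrix.trace_sub, Matrix.trace_one, Fintype.card_fin]
  have : (Bᵀ * (B * Bᵀ)⁻¹ * B).trace ≤ i := by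
    by_cases hd : IsUnit (B * Bᵀ).det
    · rw [Matrix.mul_assoc, Matrix.trace_mul_comm, Matrix.mul_assoc, Matrix.nonsing_inv_mul _ hd]
      simp
    · rw [Matrix.nonsing_inv_apply_not_isUnit _ hd]; simp
  linarith

lemma proj_diag (k : Fin n) : projMat A ω i k k = ∑ l, projMat A ω i k l ^ 2 := by
  conv_lhs => rw [← proj_idem, Matrix.mul_apply]
  refine Finset.sum_congr rfl fun l _ => ?_
  have := congrFun (congrFun (proj_symm A ω i) l) k
  rw [Matrix.transpose_apply] at this
  rw [← this, sq]

lemma proj_nonneg (k : Fin n) : 0 ≤ projMat A ω i k k := by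
  rw [proj_diag]; positivity

lemma proj_le (k l : Fin n) : |projMat A ω i k l| ≤ 1 := by
  have h : ∀ l, projMat A ω i k l ^ 2 ≤ projMat A ω i k k := by
    intro l
    conv_rhs => rw [proj_diag]
    exact Finset.single_le_sum (f := fun l => projMat A ω i k l ^ 2)
      (fun j _ => sq_nonneg _) (Finset.mem_univ l)
  have h1 := h k
  have h2 : projMat A ω i k k ≤ 1 := by nlinarith [proj_nonneg A ω i k]
  rw [← sq_le_one_iff_abs_le_one]
  exact (h l).trans h2

end proj

lemma measurable_proj {n p : ℕ} (A : Matrix (Fin n) (Fin n) ℝ) (i : ℕ) (k l : Fin n) :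
    Measurable (fun ω : Fin p → Fin n → ℝ => projMat A ω i k l) := by
  have hB : Continuous (fun ω : Fin p → Fin n → ℝ => rowMat A ω i) := by
    refine continuous_matrix fun a b => ?_
    simp only [rowMat, Matrix.of_apply, Matrix.mulVec, dotProduct]
    refine continuous_finsetSum _ fun c _ => continuous_const.mul ?_
    unfold uVec
    split_ifs
    · fun_prop
    · exact continuous_const
  have hG : Continuous (fun ω : Fin p → Fin n → ℝ => rowMat A ω i * (rowMat A ω i)ᵀ) :=
    hB.matrix_mul hB.matrix_transpose
  have hinv : ∀ a b, Measurable (fun ω : Fin p → Fin n → ℝ =>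
      (rowMat A ω i * (rowMat A ω i)ᵀ)⁻¹ a b) := by
    intro a b
    simp only [Matrix.inv_def, Ring.inverse_eq_inv', Matrix.smul_apply, smul_eq_mul]
    exact (hG.matrix_det.measurable.inv).mul ((hG.matrix_adjugate.matrix_elem a b).measurable)
  have hBm : ∀ a b, Measurable (fun ω : Fin p → Fin n → ℝ => rowMat A ω i a b) := fun a b =>
    (hB.matrix_elem a b).measurable
  have hE : ∀ ω : Fin p → Fin n → ℝ, projMat A ω i k l = (1 : Matrix (Fin n) (Fin n) ℝ) k l
      - ∑ a, (∑ b, rowMat A ω i b k * (rowMat A ω i * (rowMat A ω i)ᵀ)⁻¹ b a) * rowMat A ω i a l := by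
    intro ω
    unfold projMat
    rw [Matrix.sub_apply, Matrix.mul_apply]
    congr 1
  simp_rw [hE]
  refine measurable_const.sub (Finset.measurable_sum _ fun a _ => ?_)
  refine Measurable.mul (Finset.measurable_sum _ fun b _ => ?_) (hBm _ _)
  exact (hBm _ _).mul (hinv _ _)

lemma proj_congr {n p : ℕ} (A : Matrix (Fin n) (Fin n) ℝ) (k : Fin p) (ω ω' : Fin p → Fin n → ℝ)
    (h : ∀ j, j ≠ k → ω j = ω' j) : projMat A ω k = projMat A ω' k := by
  have : rowMat A ω (k : ℕ) = rowMat A ω' (k : ℕ) := by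
    ext a b
    simp only [rowMat, Matrix.of_apply]
    have hu : uVec ω (a : ℕ) = uVec ω' (a : ℕ) := by
      unfold uVec
      split_ifs with ha
      · exact h _ (by intro h'; have := congrArg Fin.val h'; simp at this; have := a.2; omega)
      · rfl
    rw [hu]
  unfold projMat
  rw [this]

lemma integrable_proj {n p : ℕ} (A : Matrix (Fin n) (Fin n) ℝ) (i : ℕ) (k l : Fin n) :
    Integrable (fun ω : Fin p → Fin n → ℝ => projMat A ω i k l) (sphereLaw n p) :=
  Integrable.of_bound (C := 1) (measurable_proj A i k l).aestronglyMeasurable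
    (ae_of_all _ fun ω => by simpa using proj_le A ω i k l)

lemma diag_mul_diag {n : ℕ} {A : Matrix (Fin n) (Fin n) ℝ} (hdiag : A.IsDiag)
    (P : Matrix (Fin n) (Fin n) ℝ) (k l : Fin n) : (A * P * A) k l = A k k * P k l * A l l := by
  obtain ⟨d, rfl⟩ : ∃ d, A = Matrix.diagonal d := ⟨A.diag, hdiag.diagonal_diag.symm⟩
  simp [Matrix.mul_diagonal, Matrix.diagonal_mul]

lemma Tstat_eq {n p : ℕ} {A : Matrix (Fin n) (Fin n) ℝ} (hdiag : A.IsDiag) (i : ℕ) :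
    Tstat n p A i = ∫ ω, ∑ k, A k k * projMat A ω i k k * A k k ∂(sphereLaw n p) := by
  rw [integral_finsetSum _ fun k _ => ((integrable_proj A i k k).const_mul _).mul_const _]
  simp only [integral_const_mul, integral_mul_const]
  unfold Tstat
  rw [Matrix.mul_assoc, Matrix.trace_mul_comm, Matrix.trace]
  refine Finset.sum_congr rfl fun k _ => ?_
  rw [Matrix.diag_apply, diag_mul_diag hdiag]
  rfl

lemma Tstat_pos {n p : ℕ} (hp : p ≤ n) {A : Matrix (Fin n) (Fin n) ℝ} (hdiag : A.IsDiag)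
    (hpos : ∀ k, 0 < A k k) (i : ℕ) (hi : i < p) : 0 < Tstat n p A i := by
  have : Nonempty (Fin n) := ⟨⟨0, by omega⟩⟩
  obtain ⟨m, hm⟩ := Finite.exists_min (fun k => A k k)
  have hlow : ∀ ω : Fin p → Fin n → ℝ,
      A m m * A m m ≤ ∑ k, A k k * projMat A ω i k k * A k k := by
    intro ω
    have h1 := proj_trace A ω i
    have h2 : (1:ℝ) ≤ (n : ℝ) - i := by
      have : ((i + 1 : ℕ) : ℝ) ≤ n := by exact_mod_cast (by omega)
      push_cast at this; linarith
    have hm0 := hpos m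
    calc A m m * A m m = A m m * A m m * 1 := by ring
      _ ≤ A m m * A m m * (projMat A ω i).trace := by gcongr; linarith
      _ = ∑ k, A m m * A m m * projMat A ω i k k := by rw [Matrix.trace, Finset.mul_sum]; rfl
      _ ≤ ∑ k, A k k * A k k * projMat A ω i k k := by
          refine Finset.sum_le_sum fun k _ => ?_
          have := hm k
          have := hpos k
          exact mul_le_mul_of_nonneg_right (by gcongr) (proj_nonneg A ω i k)
      _ = _ := Finset.sum_congr rfl fun k _ => by ring
  rw [Tstat_eq hdiag]
  have := integral_mono (μ := sphereLaw n p) (integrable_const (A m m * A m m))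
    (integrable_finsetSum _ fun k _ => ((integrable_proj A i k k).const_mul _).mul_const _) hlow
  simp at this
  have := mul_pos (hpos m) (hpos m)
  linarith

lemma Qmat_apply {n p : ℕ} {A : Matrix (Fin n) (Fin n) ℝ} (hdiag : A.IsDiag)
    (ω : Fin p → Fin n → ℝ) (i : ℕ) (k l : Fin n) :
    Qmat A ω i k l = (Tstat n p A i)⁻¹ * (A k k * projMat A ω i k l * A l l) := by
  unfold Qmat
  rw [Matrix.smul_apply, diag_mul_diag hdiag, smul_eq_mul]

lemma Qmat_trace {n p : ℕ} {A : Matrix (Fin n) (Fin n) ℝ} (hdiag : A.IsDiag)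
    (ω : Fin p → Fin n → ℝ) (i : ℕ) :
    (Qmat A ω i).trace = (Tstat n p A i)⁻¹ * ∑ k, A k k * projMat A ω i k k * A k k := by
  rw [Matrix.trace, Finset.mul_sum]
  exact Finset.sum_congr rfl fun k _ => Qmat_apply hdiag ω i k k

lemma Qmat_trace_mean {n p : ℕ} (hp : p ≤ n) {A : Matrix (Fin n) (Fin n) ℝ} (hdiag : A.IsDiag)
    (hpos : ∀ k, 0 < A k k) (i : ℕ) (hi : i < p) :
    ∫ ω, (Qmat A ω i).trace ∂(sphereLaw n p) = 1 := by
  simp_rw [Qmat_trace hdiag, integral_const_mul]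
  rw [← Tstat_eq hdiag, inv_mul_cancel₀ (Tstat_pos hp hdiag hpos i hi).ne']

lemma Qmat_symm {n p : ℕ} {A : Matrix (Fin n) (Fin n) ℝ} (hdiag : A.IsDiag)
    (ω : Fin p → Fin n → ℝ) (i : ℕ) (k l : Fin n) : Qmat A ω i l k = Qmat A ω i k l := by
  rw [Qmat_apply hdiag, Qmat_apply hdiag]
  have := congrFun (congrFun (proj_symm A ω i) l) k
  rw [Matrix.transpose_apply] at this
  rw [← this]; ring

lemma Qmat_meas {n p : ℕ} {A : Matrix (Fin n) (Fin n) ℝ} (hdiag : A.IsDiag) (i : ℕ) (k l : Fin n) :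
    Measurable fun ω : Fin p → Fin n → ℝ => Qmat A ω i k l := by
  simp_rw [Qmat_apply hdiag]
  have := measurable_proj (p := p) A i k l
  fun_prop

lemma Qmat_bdd {n p : ℕ} {A : Matrix (Fin n) (Fin n) ℝ} (hdiag : A.IsDiag) (i : ℕ) (k l : Fin n) :
    ∃ C, ∀ ω : Fin p → Fin n → ℝ, |Qmat A ω i k l| ≤ C := by
  refine ⟨|(Tstat n p A i)⁻¹| * (|A k k| * 1 * |A l l|), fun ω => ?_⟩
  rw [Qmat_apply hdiag, abs_mul, abs_mul, abs_mul]
  have := proj_le A ω i k l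
  gcongr

lemma integral_quad {α : Type*} [MeasurableSpace α] (μ : Measure α) [IsProbabilityMeasure μ]
    (f g : α → ℝ) (hf : Integrable f μ) (hg : Integrable g μ) (c d : ℝ) :
    ∫ x, (c * f x - d * g x + 1) ∂μ = c * (∫ x, f x ∂μ) - d * (∫ x, g x ∂μ) + 1 := by
  have h : Integrable (fun x => c * f x - d * g x) μ := (hf.const_mul c).sub (hg.const_mul d)
  rw [integral_add h (integrable_const _), integral_sub (hf.const_mul c) (hg.const_mul d),
    integral_const_mul, integral_const_mul]
  simp

lemma quad_moments {n p : ℕ} (hn : 0 < n) (k : Fin p)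
    (Q : (Fin p → Fin n → ℝ) → Matrix (Fin n) (Fin n) ℝ)
    (hQ : ∀ ω ω', (∀ j, j ≠ k → ω j = ω' j) → Q ω = Q ω')
    (hsym : ∀ ω a b, Q ω b a = Q ω a b)
    (hm : ∀ a b, Measurable fun ω => Q ω a b)
    (hb : ∀ a b, ∃ C, ∀ ω, |Q ω a b| ≤ C) :
    Integrable (fun ω => ω k ⬝ᵥ (Q ω).mulVec (ω k)) (sphereLaw n p) ∧
    Integrable (fun ω => (ω k ⬝ᵥ (Q ω).mulVec (ω k)) ^ 2) (sphereLaw n p) ∧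
    Integrable (fun ω => (Q ω).trace) (sphereLaw n p) ∧
    Integrable (fun ω => (Q ω).trace ^ 2) (sphereLaw n p) ∧
    ∫ ω, ω k ⬝ᵥ (Q ω).mulVec (ω k) ∂(sphereLaw n p)
      = 1 / (n : ℝ) * ∫ ω, (Q ω).trace ∂(sphereLaw n p) ∧
    ∫ ω, (ω k ⬝ᵥ (Q ω).mulVec (ω k)) ^ 2 ∂(sphereLaw n p)
      = 1 / ((n : ℝ) * (n + 2)) * ((∫ ω, (Q ω).trace ^ 2 ∂(sphereLaw n p))
        + 2 * ∫ ω, (Q ω * Q ω).trace ∂(sphereLaw n p)) := by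
  choose C hC using hb
  have hC0 : ∀ a b, 0 ≤ C a b := fun a b => (abs_nonneg _).trans (hC a b 0)
  -- integrability
  have I1 : ∀ a b, Integrable (fun ω => Q ω a b) (sphereLaw n p) := fun a b =>
    Integrable.of_bound (C := C a b) (hm a b).aestronglyMeasurable (ae_of_all _ fun ω => hC a b ω)
  have I2 : ∀ a b c d, Integrable (fun ω => Q ω a b * Q ω c d) (sphereLaw n p) := fun a b c d =>
    Integrable.of_bound (C := C a b * C c d) ((hm a b).mul (hm c d)).aestronglyMeasurable
      (ae_of_all _ fun ω => by
        rw [norm_mul]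
        exact mul_le_mul (hC a b ω) (hC c d ω) (norm_nonneg _) (hC0 a b))
  have J1 : ∀ a b, Integrable (fun ω => Q ω a b * (ω k a * ω k b)) (sphereLaw n p) := by
    intro a b
    refine (I1 a b).mul_bdd (c := 1) (by fun_prop) ?_
    filter_upwards [law_le hn k] with ω hω
    rw [norm_mul]
    exact mul_le_one₀ (hω a) (norm_nonneg _) (hω b)
  have J2 : ∀ a b c d, Integrable
      (fun ω => (Q ω a b * Q ω c d) * (ω k a * ω k b * ω k c * ω k d)) (sphereLaw n p) := by
    intro a b c d
    refine (I2 a b c d).mul_bdd (c := 1) (by fun_prop) ?_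
    filter_upwards [law_le hn k] with ω hω
    rw [norm_mul, norm_mul, norm_mul]
    exact mul_le_one₀ (mul_le_one₀ (mul_le_one₀ (hω a) (norm_nonneg _) (hω b))
      (norm_nonneg _) (hω c)) (norm_nonneg _) (hω d)
  -- expansions
  have E1 : ∀ ω : Fin p → Fin n → ℝ, ω k ⬝ᵥ (Q ω).mulVec (ω k)
      = ∑ t : Fin n × Fin n, Q ω t.1 t.2 * (ω k t.1 * ω k t.2) := by
    intro ω
    simp only [dotProduct, Matrix.mulVec, Finset.mul_sum, Fintype.sum_prod_type]
    exact Finset.sum_congr rfl fun a _ => Finset.sum_congr rfl fun b _ => by ring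
  have E2 : ∀ ω : Fin p → Fin n → ℝ, (ω k ⬝ᵥ (Q ω).mulVec (ω k)) ^ 2
      = ∑ s : (Fin n × Fin n) × (Fin n × Fin n), (Q ω s.1.1 s.1.2 * Q ω s.2.1 s.2.2) *
        (ω k s.1.1 * ω k s.1.2 * ω k s.2.1 * ω k s.2.2) := by
    intro ω
    rw [E1, sq, Finset.sum_mul_sum, Fintype.sum_prod_type (α₁ := Fin n × Fin n)]
    exact Finset.sum_congr rfl fun a _ => Finset.sum_congr rfl fun b _ => by ring
  have E3 : ∀ ω : Fin p → Fin n → ℝ, (Q ω).trace ^ 2 = ∑ a, ∑ b, Q ω a a * Q ω b b := by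
    intro ω
    rw [sq, Matrix.trace, Finset.sum_mul_sum]; rfl
  have E4 : ∀ ω : Fin p → Fin n → ℝ, (Q ω * Q ω).trace = ∑ a, ∑ b, Q ω a b * Q ω a b := by
    intro ω
    simp only [Matrix.trace, Matrix.diag_apply, Matrix.mul_apply]
    exact Finset.sum_congr rfl fun a _ => Finset.sum_congr rfl fun b _ => by rw [hsym ω a b]
  have I3 : Integrable (fun ω => (Q ω).trace) (sphereLaw n p) :=
    integrable_finsetSum _ fun a _ => I1 a a
  have I4 : Integrable (fun ω => (Q ω).trace ^ 2) (sphereLaw n p) := by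
    simp_rw [E3]
    exact integrable_finsetSum _ fun a _ => integrable_finsetSum _ fun b _ => I2 a a b b
  have I5 : Integrable (fun ω => (Q ω * Q ω).trace) (sphereLaw n p) := by
    simp_rw [E4]
    exact integrable_finsetSum _ fun a _ => integrable_finsetSum _ fun b _ => I2 a b a b
  refine ⟨?_, ?_, I3, I4, ?_, ?_⟩
  · simp_rw [E1]
    exact integrable_finsetSum _ fun t _ => J1 t.1 t.2
  · simp_rw [E2]
    exact integrable_finsetSum _ fun s _ => J2 _ _ _ _
  · simp_rw [E1]
    rw [integral_finsetSum _ fun t _ => J1 t.1 t.2, ← integral_const_mul]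
    have F : ∀ a b, ∫ ω, Q ω a b * (ω k a * ω k b) ∂(sphereLaw n p)
        = ∫ ω, Q ω a b * (1 / (n : ℝ) * (if a = b then 1 else 0)) ∂(sphereLaw n p) := by
      intro a b
      rw [integral_factor k (fun ω => Q ω a b) (fun x => x a * x b)
        (fun ω ω' h => by rw [hQ ω ω' h]), M2_eq hn, integral_mul_const]
    simp_rw [F]
    rw [← integral_finsetSum _ fun t _ => (I1 t.1 t.2).mul_const _]
    congr 1; funext ω
    simp only [Fintype.sum_prod_type, Matrix.trace, Matrix.diag_apply, Finset.mul_sum]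
    refine Finset.sum_congr rfl fun a _ => ?_
    simp [mul_comm]
  · simp_rw [E2]
    rw [integral_finsetSum _ fun s _ => J2 _ _ _ _, ← integral_const_mul 2,
      ← integral_add I4 (I5.const_mul 2), ← integral_const_mul]
    have F : ∀ a b c d, ∫ ω, (Q ω a b * Q ω c d) * (ω k a * ω k b * ω k c * ω k d) ∂(sphereLaw n p)
        = ∫ ω, (Q ω a b * Q ω c d) * M4 a b c d ∂(sphereLaw n p) := by
      intro a b c d
      rw [integral_factor k (fun ω => Q ω a b * Q ω c d) (fun x => x a * x b * x c * x d)
        (fun ω ω' h => by rw [hQ ω ω' h]), integral_mul_const]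
      rfl
    simp_rw [F]
    rw [← integral_finsetSum _ fun s _ => (I2 _ _ _ _).mul_const _]
    congr 1; funext ω
    rw [E3, E4]
    simp only [Fintype.sum_prod_type, M4_eq hn]
    have R : ∀ a b c d : Fin n, Q ω a b * Q ω c d * (1 / ((n : ℝ) * (n + 2)) *
        ((if a = b then (if c = d then 1 else 0) else 0)
        + (if a = c then (if b = d then 1 else 0) else 0)
        + (if a = d then (if b = c then 1 else 0) else 0)))
        = 1 / ((n : ℝ) * (n + 2)) * ((if a = b then (if c = d then Q ω a b * Q ω c d else 0) else 0)
        + (if a = c then (if b = d then Q ω a b * Q ω c d else 0) else 0)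
        + (if a = d then (if b = c then Q ω a b * Q ω c d else 0) else 0)) := by
      intro a b c d
      split_ifs <;> ring
    simp_rw [R, ← Finset.mul_sum, Finset.sum_add_distrib]
    congr 1
    have S1 : ∑ a, ∑ b, ∑ c, ∑ d, (if a = b then (if c = d then Q ω a b * Q ω c d else 0) else 0)
        = ∑ a, ∑ b, Q ω a a * Q ω b b := by
      refine Finset.sum_congr rfl fun a _ => ?_
      rw [Finset.sum_eq_single a (by intro b _ h; simp [Ne.symm h]) (by simp)]
      simp
    have S2 : ∑ a, ∑ b, ∑ c, ∑ d, (if a = c then (if b = d then Q ω a b * Q ω c d else 0) else 0)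
        = ∑ a, ∑ b, Q ω a b * Q ω a b := by
      refine Finset.sum_congr rfl fun a _ => Finset.sum_congr rfl fun b _ => ?_
      rw [Finset.sum_eq_single a (by intro b _ h; simp [Ne.symm h]) (by simp)]
      simp
    have S3 : ∑ a, ∑ b, ∑ c, ∑ d, (if a = d then (if b = c then Q ω a b * Q ω c d else 0) else 0)
        = ∑ a, ∑ b, Q ω a b * Q ω a b := by
      refine Finset.sum_congr rfl fun a _ => Finset.sum_congr rfl fun b _ => ?_
      rw [Finset.sum_eq_single b (by intro b _ h; simp [Ne.symm h]) (by simp)]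
      simp [hsym ω a b]
    have S0 : ∑ a, Q ω a a * ∑ b, Q ω b b = ∑ a, ∑ b, Q ω a a * Q ω b b := by
      simp_rw [Finset.mul_sum]
    rw [S1, S2, S3, S0]
    ring

/-- For `0 ≤ i ≤ p−1`,
`E[Z̃_{i+1}²] = (n²β₄ − 1)(E[tr(Q_i²)] − 1/(n−1)) + E[tr(Q_i²)](n²β₄ − 1)/(n−1)
  + n²β_{2,2} Var(tr(Q_i))`,
where `β₄ = 3/(n(n+2))` and `β_{2,2} = 1/(n(n+2))` are the fourth-order moments of the
components of a uniform random point on `S^{n-1}`. -/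
theorem secondMoment_Ztil {n p : ℕ} (hp : p ≤ n)
    (A : Matrix (Fin n) (Fin n) ℝ) (hdiag : A.IsDiag) (hpos : ∀ k, 0 < A k k)
    (htr : Matrix.trace (A * A) = (n : ℝ))
    (i : ℕ) (hi : i < p) :
    (∫ ω, (Ztil A ω i) ^ 2 ∂(sphereLaw n p)) =
      ((n : ℝ) ^ 2 * ((3 : ℝ) / ((n : ℝ) * ((n : ℝ) + 2))) - 1) *
          ((∫ ω, Matrix.trace (Qmat A ω i * Qmat A ω i) ∂(sphereLaw n p)) - 1 / ((n : ℝ) - 1))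
        + (∫ ω, Matrix.trace (Qmat A ω i * Qmat A ω i) ∂(sphereLaw n p)) *
            ((n : ℝ) ^ 2 * ((3 : ℝ) / ((n : ℝ) * ((n : ℝ) + 2))) - 1) / ((n : ℝ) - 1)
        + (n : ℝ) ^ 2 * ((1 : ℝ) / ((n : ℝ) * ((n : ℝ) + 2))) *
            varInt (sphereLaw n p) (fun ω => Matrix.trace (Qmat A ω i)) := by
  have hn : 0 < n := by omega
  obtain ⟨h1, h2, h3, h4, h5, h6⟩ := quad_moments hn (⟨i, hi⟩ : Fin p) (fun ω => Qmat A ω i)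
    (fun ω ω' h => by
      unfold Qmat
      rw [proj_congr A (⟨i, hi⟩ : Fin p) ω ω' h])
    (fun ω a b => Qmat_symm hdiag ω i a b) (fun a b => Qmat_meas hdiag i a b)
    (fun a b => Qmat_bdd hdiag i a b)
  have ht := Qmat_trace_mean hp hdiag hpos i hi
  have hu : ∀ ω : Fin p → Fin n → ℝ, uVec ω i = ω ⟨i, hi⟩ := fun ω => by simp [uVec, hi]
  have hL : ∫ ω, (Ztil A ω i) ^ 2 ∂(sphereLaw n p) =
      (n : ℝ) ^ 2 * (∫ ω, (ω ⟨i, hi⟩ ⬝ᵥ (Qmat A ω i).mulVec (ω ⟨i, hi⟩)) ^ 2 ∂(sphereLaw n p))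
      - 2 * n * (∫ ω, (ω ⟨i, hi⟩ ⬝ᵥ (Qmat A ω i).mulVec (ω ⟨i, hi⟩)) ∂(sphereLaw n p)) + 1 := by
    have e : ∀ ω : Fin p → Fin n → ℝ, (Ztil A ω i) ^ 2 =
        (n : ℝ) ^ 2 * (ω ⟨i, hi⟩ ⬝ᵥ (Qmat A ω i).mulVec (ω ⟨i, hi⟩)) ^ 2
        - 2 * n * (ω ⟨i, hi⟩ ⬝ᵥ (Qmat A ω i).mulVec (ω ⟨i, hi⟩)) + 1 := by
      intro ω
      unfold Ztil
      rw [hu]; ring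
    simp_rw [e]
    exact integral_quad _ _ _ h2 h1 _ _
  have hV : varInt (sphereLaw n p) (fun ω => Matrix.trace (Qmat A ω i)) =
      (∫ ω, (Qmat A ω i).trace ^ 2 ∂(sphereLaw n p)) - 1 := by
    unfold varInt
    rw [ht]
    have e : ∀ ω : Fin p → Fin n → ℝ, ((Qmat A ω i).trace - 1) ^ 2 =
        1 * (Qmat A ω i).trace ^ 2 - 2 * (Qmat A ω i).trace + 1 := fun ω => by ring
    simp_rw [e]
    rw [integral_quad _ _ _ h4 h3 1 2, ht]
    ring
  rw [hL, hV, h5, h6, ht]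
  obtain rfl | hn2 : n = 1 ∨ 2 ≤ n := by omega
  · have e : ∀ ω : Fin p → Fin 1 → ℝ, (Qmat A ω i * Qmat A ω i).trace = (Qmat A ω i).trace ^ 2 := by
      intro ω
      simp [Matrix.trace, Matrix.mul_apply, sq]
    have i0 : i = 0 := by omega
    have one : ∀ ω : Fin p → Fin 1 → ℝ, (Qmat A ω i).trace = 1 := by
      have hc : ∀ ω : Fin p → Fin 1 → ℝ, (Qmat A ω i).trace = (Qmat A (0 : Fin p → Fin 1 → ℝ) i).trace := by
        intro ω
        have : projMat A ω i = projMat A (0 : Fin p → Fin 1 → ℝ) i := by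
          subst i0
          unfold projMat
          congr 2
          ext a
          exact a.elim0
        unfold Qmat
        rw [this]
      intro ω
      rw [hc]
      simp_rw [hc] at ht
      simpa using ht
    simp_rw [e, one]
    norm_num
  · have h2' : (2:ℝ) ≤ n := by exact_mod_cast hn2
    have hne : (n : ℝ) - 1 ≠ 0 := by linarith
    have hne2 : (n : ℝ) ≠ 0 := by linarith
    have hne3 : (n : ℝ) + 2 ≠ 0 := by linarith
    field_simp
    ring
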